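/- arXiv:1510.03917 — 5 statements merged into one kernel-verified Lean document; each statement's English description precedes it below -/
import Mathlib

section
/- Let q ≥ 1 be an integer and let L be a word over [q] consisting of a single letter (so L is bifix-free of length ℓ = 1). Then the counting sequences c_n = c_n^1 and d_n = d_n^1 satisfy: c_1 = c_2 = 0; c_3 = q; c_4 = q·c_3 − 1; c_5 = q·c_4 − (c_3 − 1); c_6 = q·(c_5 + c_3 − 1) − (c_3 − 1); c_{2k} = q·(c_{2k−1} + c_k) − c_k for every k > 3; c_{2k+1} = q·c_{2k} − c_{k+1} for every k > 2; d_1 = d_2 = d_3 = d_4 = 0; d_5 = q − 1; d_6 = q·(d_5 + 1) − 1; d_{2k} = q·(d_{2k−1} + d_k) − (d_k + d_{k+1}) for every k > 3; and d_{2k+1} = q·(d_{2k} + d_{k+1}) − d_{k+1} for every k > 2. -/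
/-- `V` is a bifix of `W`: `V` is nonempty and is both a proper prefix
and a proper suffix of `W`. -/
def IsBifix {α : Type*} (V W : List α) : Prop :=
  V ≠ [] ∧ (∃ A, A ≠ [] ∧ W = V ++ A) ∧ (∃ B, B ≠ [] ∧ W = B ++ V)

/-- A word is bifix-free if it has no bifix. -/
def BifixFree {α : Type*} (W : List α) : Prop := ∀ V, ¬ IsBifix V W

/-- A word is a `Z₂`-instance if it has the form `ABA` with `A, B` nonempty. -/
def Z2Instance {α : Type*} (W : List α) : Prop :=
  ∃ A B : List α, A ≠ [] ∧ B ≠ [] ∧ W = A ++ B ++ A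

/-- A word is `Z₂`-bifix-free if it has no bifix that is a `Z₂`-instance. -/
def Z2BifixFree {α : Type*} (W : List α) : Prop :=
  ∀ V, ¬ (IsBifix V W ∧ Z2Instance V)

/-- For a fixed word `L`, `dCount q L n` counts the `Z₂`-bifix-free words `W` of
length `n` over `[q]` with `W = LAL` for some nonempty `A` that moreover have the
form `W = LLA′LL` for some nonempty `A′`. -/
noncomputable def dCount (q : ℕ) (L : List (Fin q)) (n : ℕ) : ℕ :=
  Nat.card {W : List (Fin q) // W.length = n ∧ (∃ A, A ≠ [] ∧ W = L ++ A ++ L) ∧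
    (∃ A', A' ≠ [] ∧ W = L ++ L ++ A' ++ L ++ L) ∧ Z2BifixFree W}

/-- For a fixed word `L`, `cCount q L n` counts the `Z₂`-bifix-free words `W` of
length `n` over `[q]` with `W = LAL` for some nonempty `A` that are not of the
form `W = LLA′LL` for a nonempty `A′`. -/
noncomputable def cCount (q : ℕ) (L : List (Fin q)) (n : ℕ) : ℕ :=
  Nat.card {W : List (Fin q) // W.length = n ∧ (∃ A, A ≠ [] ∧ W = L ++ A ++ L) ∧
    ¬ (∃ A', A' ≠ [] ∧ W = L ++ L ++ A' ++ L ++ L) ∧ Z2BifixFree W}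

/-- The word `w` of length `n` (padded to an infinite sequence) has a border of length `m`. -/
def HasBorder {α : Type*} (w : ℕ → α) (n m : ℕ) : Prop :=
  ∀ i < m, w i = w (n - m + i)

/-- Words of length `n`, padded with the letter `a`, that start and end with `a`, have no
border of length between `3` and `t`, and for which `P` holds of the proposition that the
second and the last but one letter are both `a`. -/
def borderless {α : Type*} (a : α) (P : Prop → Prop) (n t : ℕ) : Set (ℕ → α) :=
  {w | (∀ i, n ≤ i → w i = a) ∧ w 0 = a ∧ w (n - 1) = a ∧ P (w 1 = a ∧ w (n - 2) = a) ∧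
    ∀ m, 3 ≤ m → m ≤ t → ¬ HasBorder w n m}

theorem borderless_finite {α : Type*} [Finite α] (a : α) (P : Prop → Prop) (n t : ℕ) :
    (borderless a P n t).Finite := by
  refine Set.Finite.of_finite_image (f := fun w (i : Fin n) => w i) (Set.toFinite _) ?_
  intro w hw v hv h
  funext i
  by_cases hi : i < n
  · exact congrFun h ⟨i, hi⟩
  · rw [hw.1 i (by omega), hv.1 i (by omega)]

/-- Inserting an arbitrary letter in the middle does not affect short borders. -/
theorem borderless_ncard_succ {α : Type*} (a : α) (P : Prop → Prop) {n t : ℕ}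
    (hn : 4 ≤ n) (ht : 2 * t ≤ n) :
    (borderless a P (n + 1) t).ncard = Nat.card α * (borderless a P n t).ncard := by
  rw [← Nat.card_coe_set_eq, ← Nat.card_coe_set_eq, ← Nat.card_prod]
  obtain ⟨j, hj⟩ : ∃ j, j = n / 2 := ⟨_, rfl⟩
  have key : ∀ (w v : ℕ → α), (∀ i < j, w i = v i) → (∀ i, j ≤ i → w (i + 1) = v i) →
      (w ∈ borderless a P (n + 1) t ↔ v ∈ borderless a P n t) := by
    intro w v h1 h2
    have e0 : w 0 = v 0 := h1 0 (by omega)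
    have e1 : w 1 = v 1 := h1 1 (by omega)
    have e2 : w (n + 1 - 1) = v (n - 1) := by
      rw [← h2 (n - 1) (by omega)]; congr 1; omega
    have e3 : w (n + 1 - 2) = v (n - 2) := by
      rw [← h2 (n - 2) (by omega)]; congr 1; omega
    have e4 : (∀ i, n + 1 ≤ i → w i = a) ↔ (∀ i, n ≤ i → v i = a) := by
      constructor
      · intro h i hi
        rw [← h2 i (by omega)]; exact h _ (by omega)
      · intro h i hi
        obtain ⟨i, rfl⟩ : ∃ i', i = i' + 1 := ⟨i - 1, by omega⟩
        rw [h2 i (by omega)]; exact h _ (by omega)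
    have e5 : ∀ m ≤ t, HasBorder w (n + 1) m ↔ HasBorder v n m := by
      intro m hm
      refine forall₂_congr fun i hi => ?_
      rw [h1 i (by omega), ← h2 (n - m + i) (by omega)]
      rw [show n + 1 - m + i = n - m + i + 1 by omega]
    simp only [borderless, Set.mem_ofPred_eq, e0, e1, e2, e3, e4]
    refine and_congr_right fun _ => and_congr_right fun _ => and_congr_right fun _ =>
      and_congr_right fun _ => forall₃_congr fun m _ hm => ?_
    rw [e5 m hm]
  refine Nat.card_congr
    { toFun := fun w => (w.1 j, ⟨fun i => if i < j then w.1 i else w.1 (i + 1),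
        (key w.1 _ (by intro i hi; simp [hi]) (by intro i hi; simp [hi])).1 w.2⟩)
      invFun := fun p => ⟨fun i => if i < j then p.2.1 i else if i = j then p.1
          else p.2.1 (i - 1),
        (key _ p.2.1 (by intro i hi; simp [hi])
          (by intro i hi; grind)).2 p.2.2⟩
      left_inv := ?_
      right_inv := ?_ }
  · rintro ⟨w, hw⟩
    ext i
    grind
  · rintro ⟨x, v, hv⟩
    refine Prod.ext (by simp) (Subtype.ext (funext fun i => ?_))
    grind

/-- Splitting off the words whose shortest border of length at least `3` has length `t`. -/
theorem borderless_ncard_split {α : Type*} [Finite α] (a : α) (P : Prop → Prop) {n t : ℕ}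
    (ht : 2 ≤ t) :
    (borderless a P n t).ncard = (borderless a P n (t + 1)).ncard +
      {w ∈ borderless a P n t | HasBorder w n (t + 1)}.ncard := by
  rw [← Set.ncard_union_eq ?_ (borderless_finite ..)
    ((borderless_finite a P n t).subset (Set.sep_subset _ _))]
  · congr 1
    ext w
    constructor
    · intro hw
      by_cases h : HasBorder w n (t + 1)
      · exact Or.inr ⟨hw, h⟩
      · refine Or.inl ⟨hw.1, hw.2.1, hw.2.2.1, hw.2.2.2.1, fun m h3 hm => ?_⟩
        rcases Nat.lt_or_ge t m with h' | h'
        · rwa [show m = t + 1 by omega]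
        · exact hw.2.2.2.2 m h3 h'
    · rintro (hw | hw)
      · exact ⟨hw.1, hw.2.1, hw.2.2.1, hw.2.2.2.1, fun m h3 hm => hw.2.2.2.2 m h3 (by omega)⟩
      · exact hw.1
  · rw [Set.disjoint_left]
    intro w hw hw'
    exact hw.2.2.2.2 _ (by omega) le_rfl hw'.2

/-- A word of length `2 * (t + 1) - s` with a border of length `t + 1` is determined by this
border, whose prefix and suffix of length `s` agree. -/
theorem borderless_ncard_border {α : Type*} (a : α) (P : Prop → Prop) {n t s : ℕ}
    (ht : 2 ≤ t) (hs : s ≤ 2) (hn : n + s = 2 * (t + 1))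
    (hP : ∀ v ∈ borderless a P (t + 1) t, HasBorder v (t + 1) s) :
    {w ∈ borderless a P n t | HasBorder w n (t + 1)}.ncard =
      (borderless a P (t + 1) t).ncard := by
  rw [← Nat.card_coe_set_eq, ← Nat.card_coe_set_eq]
  have key : ∀ (w v : ℕ → α), (∀ i < t + 1, w i = v i) →
      (∀ i, i ≤ t → w (t + 1 - s + i) = v i) → (∀ i, n ≤ i → w i = a) →
      (∀ i, t + 1 ≤ i → v i = a) →
      (w ∈ borderless a P n t ↔ v ∈ borderless a P (t + 1) t) := by
    intro w v h1 h2 h3 h4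
    have e0 : w 0 = v 0 := h1 0 (by omega)
    have e1 : w 1 = v 1 := h1 1 (by omega)
    have e2 : w (n - 1) = v (t + 1 - 1) := by
      rw [← h2 (t + 1 - 1) (by omega)]; congr 1; omega
    have e3 : w (n - 2) = v (t + 1 - 2) := by
      rw [← h2 (t + 1 - 2) (by omega)]; congr 1; omega
    have e5 : ∀ m ≤ t, HasBorder w n m ↔ HasBorder v (t + 1) m := by
      intro m hm
      refine forall₂_congr fun i hi => ?_
      rw [h1 i (by omega), ← h2 (t + 1 - m + i) (by omega)]
      rw [show n - m + i = t + 1 - s + (t + 1 - m + i) by omega]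
    simp only [borderless, Set.mem_ofPred_eq, e0, e1, e2, e3]
    refine and_congr (iff_of_true h3 h4) (and_congr_right fun _ => and_congr_right fun _ =>
      and_congr_right fun _ => forall₃_congr fun m _ hm => ?_)
    rw [e5 m hm]
  refine Nat.card_congr
    { toFun := fun w => ⟨fun i => if i < t + 1 then w.1 i else a, (key w.1 _ ?_ ?_ ?_ ?_).1 w.2.1⟩
      invFun := fun v => ⟨fun i => if i < t + 1 then v.1 i else v.1 (i - (t + 1 - s)),
        (key _ v.1 ?_ ?_ ?_ ?_).2 v.2, ?_⟩
      left_inv := ?_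
      right_inv := ?_ }
  · intro i hi; simp [hi]
  · intro i hi
    have := w.2.2 i (by omega)
    rw [show n - (t + 1) + i = t + 1 - s + i by omega] at this
    simp [this.symm, show i < t + 1 by omega]
  · exact w.2.1.1
  · intro i hi; simp; omega
  · intro i hi; simp [hi]
  · intro i hi
    by_cases h : t + 1 - s + i < t + 1
    · have := hP v.1 v.2 i (by omega)
      simp [h, this]
    · simp [h]
  · intro i hi
    have := v.2.1 (i - (t + 1 - s)) (by omega)
    simp only [this]
    rw [if_neg (by omega)]
  · exact v.2.1
  · intro i hi
    rw [show n - (t + 1) + i = t + 1 - s + i by omega]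
    by_cases h : t + 1 - s + i < t + 1
    · have := hP v.1 v.2 i (by omega)
      simp only [h, hi, if_true, this]
    · simp only [h, hi, if_true, if_false, Nat.add_sub_cancel_left]
  · rintro ⟨w, hw, hb⟩
    refine Subtype.ext (funext fun i => ?_)
    by_cases h : i < t + 1
    · simp [h]
    · simp only [h, if_false]
      split_ifs with h'
      · rw [hb _ h']; congr 1; omega
      · exact (hw.1 i (by omega)).symm
  · rintro ⟨v, hv⟩
    refine Subtype.ext (funext fun i => ?_)
    by_cases h : i < t + 1
    · simp [h]
    · simp only [h, if_false]
      exact (hv.1 i (by omega)).symm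

/-- A long border of a word forces a shorter one. -/
theorem borderless_eq_of_le {α : Type*} (a : α) (P : Prop → Prop) {n t u : ℕ}
    (ht : n + 2 < 2 * (t + 1)) (htu : t ≤ u) (hu : u < n) :
    borderless a P n t = borderless a P n u := by
  ext w
  refine and_congr_right fun _ => and_congr_right fun _ => and_congr_right fun _ =>
    and_congr_right fun _ => ⟨fun h m => ?_, fun h m h3 hm => h m h3 (by omega)⟩
  induction m using Nat.strong_induction_on with
  | _ m ih =>
    intro h3 hm hb
    rcases Nat.lt_or_ge t m with h' | h'
    · refine ih (2 * m - n) (by omega) (by omega) (by omega) fun i hi => ?_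
      rw [hb i (by omega), hb (n - m + i) (by omega)]
      congr 1; omega
    · exact h m h3 h' hb

section recursion

variable {α : Type*} [Finite α] (a : α) (P : Prop → Prop)

theorem borderless_ncard_odd {k : ℕ} (hk : 2 ≤ k) :
    (borderless a P (2 * k + 1) (2 * k)).ncard + (borderless a P (k + 1) k).ncard =
      Nat.card α * (borderless a P (2 * k) k).ncard := by
  rw [← borderless_ncard_succ a P (by omega) le_rfl,
    borderless_ncard_split a P (n := 2 * k + 1) (t := k) hk,
    borderless_ncard_border a P (s := 1) hk (by omega) (by omega),
    borderless_eq_of_le a P (t := k + 1) (u := 2 * k) (by omega) (by omega) (by omega)]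
  rintro v hv i hi
  obtain rfl : i = 0 := by omega
  rw [hv.2.1]; exact hv.2.2.1.symm

theorem borderless_ncard_middle {k : ℕ} (hk : 3 ≤ k) :
    (borderless a P (2 * k) k).ncard + (borderless a P k (k - 1)).ncard =
      Nat.card α * (borderless a P (2 * k - 1) (k - 1)).ncard := by
  obtain ⟨k, rfl⟩ : ∃ j, k = j + 1 := ⟨k - 1, by omega⟩
  rw [← borderless_ncard_succ a P (by omega) (by omega),
    show 2 * (k + 1) - 1 + 1 = 2 * (k + 1) by omega, Nat.add_sub_cancel,
    borderless_ncard_split a P (n := 2 * (k + 1)) (t := k) (by omega),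
    borderless_ncard_border a P (s := 0) (by omega) (by omega) (by omega)]
  intro v hv i hi
  omega

theorem borderless_ncard_middle_odd {k : ℕ} (hk : 3 ≤ k) :
    (borderless a P (2 * k - 1) (k - 1)).ncard =
      (borderless a P (2 * k - 1) (2 * k - 2)).ncard + (borderless a P k (k - 1)).ncard := by
  obtain ⟨k, rfl⟩ : ∃ j, k = j + 1 := ⟨k - 1, by omega⟩
  rw [Nat.add_sub_cancel, borderless_ncard_split a P (by omega),
    borderless_ncard_border a P (s := 1) (by omega) (by omega) (by omega),
    borderless_eq_of_le a P (t := k + 1) (u := 2 * (k + 1) - 2) (by omega) (by omega) (by omega)]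
  rintro v hv i hi
  obtain rfl : i = 0 := by omega
  rw [hv.2.1]; exact hv.2.2.1.symm

theorem borderless_id_ncard_even {k : ℕ} (hk : 2 ≤ k) :
    (borderless a id (2 * k) k).ncard =
      (borderless a id (2 * k) (2 * k - 1)).ncard + (borderless a id (k + 1) k).ncard := by
  rw [borderless_ncard_split a id hk,
    borderless_ncard_border a id (s := 2) (by omega) (by omega) (by omega),
    borderless_eq_of_le a id (t := k + 1) (u := 2 * k - 1) (by omega) (by omega) (by omega)]
  rintro v hv i hi
  obtain rfl | rfl : i = 0 ∨ i = 1 := by omega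
  · rw [hv.2.1]; exact hv.2.2.2.1.2.symm
  · rw [hv.2.2.2.1.1, show k + 1 - 2 + 1 = k + 1 - 1 by omega]
    exact hv.2.2.1.symm

theorem borderless_not_ncard_even {k : ℕ} (hk : 2 ≤ k) :
    (borderless a Not (2 * k) k).ncard = (borderless a Not (2 * k) (2 * k - 1)).ncard := by
  rw [borderless_ncard_split a Not hk,
    borderless_eq_of_le a Not (t := k + 1) (u := 2 * k - 1) (by omega) (by omega) (by omega),
    Nat.add_eq_left, Set.ncard_eq_zero
      ((borderless_finite a Not (2 * k) k).subset (Set.sep_subset _ _)),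
    Set.eq_empty_iff_forall_notMem]
  rintro w ⟨⟨-, h0, h1, h, -⟩, hb⟩
  have b0 := hb 0 (by omega)
  have b1 := hb 1 (by omega)
  have b2 := hb (k - 1) (by omega)
  have b3 := hb k (by omega)
  rw [show 2 * k - (k + 1) + 0 = k - 1 by omega] at b0
  rw [show 2 * k - (k + 1) + 1 = k by omega] at b1
  rw [show 2 * k - (k + 1) + (k - 1) = 2 * k - 2 by omega] at b2
  rw [show 2 * k - (k + 1) + k = 2 * k - 1 by omega] at b3
  exact h ⟨by rw [b1, b3, h1], by rw [← b2, ← b0, h0]⟩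

theorem borderless_id_add_not (n t : ℕ) :
    (borderless a id n t).ncard + (borderless a Not n t).ncard =
      (borderless a (fun _ => True) n t).ncard := by
  rw [← Set.ncard_union_eq _ (borderless_finite ..) (borderless_finite ..)]
  · congr 1
    ext w
    simp only [borderless, Set.mem_union, Set.mem_ofPred_eq, id]
    tauto
  · rw [Set.disjoint_left]
    exact fun w hw hw' => hw'.2.2.2.1 hw.2.2.2.1

end recursion

theorem borderless_true_three {α : Type*} (a : α) :
    (borderless a (fun _ => True) 3 2).ncard = Nat.card α := by
  rw [← Nat.card_coe_set_eq]
  refine Nat.card_congr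
    { toFun := fun w => w.1 1
      invFun := fun x => ⟨fun i => if i = 1 then x else a, ?_⟩
      left_inv := ?_
      right_inv := fun x => by simp }
  · refine ⟨fun i hi => if_neg (by omega), by simp, by simp, trivial, fun m h h' => by omega⟩
  · rintro ⟨w, hw⟩
    refine Subtype.ext (funext fun i => ?_)
    have h0 := hw.2.1
    have h1 := hw.2.2.1
    have h2 := hw.1 i
    obtain rfl | rfl | rfl | h : i = 0 ∨ i = 1 ∨ i = 2 ∨ 3 ≤ i := by omega
    all_goals grind

theorem borderless_true_four {α : Type*} (a : α) :
    (borderless a (fun _ => True) 4 2).ncard = Nat.card α * Nat.card α := by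
  rw [← Nat.card_coe_set_eq, ← Nat.card_prod]
  refine Nat.card_congr
    { toFun := fun w => (w.1 1, w.1 2)
      invFun := fun x => ⟨fun i => if i = 1 then x.1 else if i = 2 then x.2 else a, ?_⟩
      left_inv := ?_
      right_inv := fun x => by simp }
  · refine ⟨fun i hi => ?_, by simp, by simp, trivial, fun m h h' => by omega⟩
    simp [show i ≠ 1 by omega, show i ≠ 2 by omega]
  · rintro ⟨w, hw⟩
    refine Subtype.ext (funext fun i => ?_)
    have h0 := hw.2.1
    have h1 := hw.2.2.1
    have h2 := hw.1 i
    obtain rfl | rfl | rfl | rfl | h : i = 0 ∨ i = 1 ∨ i = 2 ∨ i = 3 ∨ 4 ≤ i := by omega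
    all_goals grind

theorem borderless_id_of_le_four {α : Type*} (a : α) {n : ℕ} (hn : 3 ≤ n) (hn' : n ≤ 4) :
    (borderless a id n 2).ncard = 1 := by
  rw [Set.ncard_eq_one]
  refine ⟨fun _ => a, Set.eq_singleton_iff_unique_mem.2
    ⟨⟨fun _ _ => rfl, rfl, rfl, ⟨rfl, rfl⟩, fun m h h' => by omega⟩, ?_⟩⟩
  rintro w ⟨h, h0, h1, ⟨h2, h3⟩, -⟩
  funext i
  obtain rfl | rfl | rfl | rfl | hi : i = 0 ∨ i = 1 ∨ i = n - 1 ∨ i = n - 2 ∨ n ≤ i := by omega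
  all_goals first | assumption | exact h i hi

/-- A word starting and ending with the same letter is `Z₂`-bifix-free if and only if it has
no border of length at least `3`. -/
theorem z2BifixFree_iff {α : Type*} {a : α} {W : List α} {n : ℕ} (hW : W.length = n)
    (h0 : W.getD 0 a = a) (h1 : W.getD (n - 1) a = a) :
    Z2BifixFree W ↔ ∀ m, 3 ≤ m → m ≤ n - 1 → ¬ HasBorder (fun i => W.getD i a) n m := by
  constructor
  · intro h m h3 hm hb
    have hpre : W = W.take m ++ W.drop m := (List.take_append_drop m W).symm
    have heq : W.drop (n - m) = W.take m := by
      refine List.ext_getElem (by simp; omega) fun i hi hi' => ?_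
      have hi'' : i < m := by simp at hi'; omega
      have := hb i hi''
      simp only [List.getD_eq_getElem _ _ (show i < W.length by omega),
        List.getD_eq_getElem _ _ (show n - m + i < W.length by omega)] at this
      simp [this]
    refine h (W.take m) ⟨⟨?_, ⟨W.drop m, ?_, hpre⟩, ⟨W.take (n - m), ?_, ?_⟩⟩, ?_⟩
    · apply List.ne_nil_of_length_pos; simp; omega
    · apply List.ne_nil_of_length_pos; simp; omega
    · apply List.ne_nil_of_length_pos; simp; omega
    · rw [← heq, List.take_append_drop]
    · refine ⟨[a], (W.take (m - 1)).drop 1, by simp, ?_, ?_⟩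
      · apply List.ne_nil_of_length_pos; simp; omega
      · have hm1 := hb (m - 1) (by omega)
        simp only [show n - m + (m - 1) = n - 1 by omega, h1] at hm1
        rw [List.getD_eq_getElem _ _ (by omega)] at hm1 h0
        refine List.ext_getElem (by simp; omega) fun i hi hi' => ?_
        have hi'' : i < m := by simp at hi; omega
        obtain rfl | rfl | h : i = 0 ∨ i = m - 1 ∨ (1 ≤ i ∧ i < m - 1) := by omega
        · simp [h0]
        · rw [List.getElem_append_right (by simp; omega)]
          simp [hm1]
        · rw [List.getElem_append_left (by simp; omega),
            List.getElem_append_right (by simp; omega)]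
          simp only [List.getElem_take, List.getElem_drop, List.length_singleton]
          congr 1; omega
  · rintro h V ⟨⟨-, ⟨A, hA, rfl⟩, ⟨B, hB, hAB⟩⟩, ⟨C, D, hC, hD, rfl⟩⟩
    have lC := List.length_pos_of_ne_nil hC
    have lD := List.length_pos_of_ne_nil hD
    have lA := List.length_pos_of_ne_nil hA
    generalize hV : C ++ D ++ C = V at *
    have lV : V.length = C.length + D.length + C.length := by
      simp [← hV, Nat.add_assoc]
    have lW : n = B.length + V.length := by rw [← hW, hAB]; simp
    rw [List.length_append] at hW
    refine h V.length (by omega) (by omega) fun i hi => ?_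
    simp only
    rw [List.getD_append _ _ _ _ hi, hAB, List.getD_append_right _ _ _ _ (by omega)]
    congr 1; omega

theorem exists_eq_cons_append_iff {α : Type*} {a : α} {W : List α} {n : ℕ}
    (hW : W.length = n) (hn : 3 ≤ n) :
    (∃ A, A ≠ [] ∧ W = [a] ++ A ++ [a]) ↔ W.getD 0 a = a ∧ W.getD (n - 1) a = a := by
  constructor
  · rintro ⟨A, -, rfl⟩
    simp at hW
    subst hW
    simp
  · rintro ⟨h0, h1⟩
    rw [List.getD_eq_getElem _ _ (by omega)] at h0 h1
    refine ⟨(W.take (n - 1)).drop 1, ?_, ?_⟩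
    · apply List.ne_nil_of_length_pos; simp; omega
    · refine List.ext_getElem (by simp; omega) fun i hi hi' => ?_
      obtain rfl | rfl | h : i = 0 ∨ i = n - 1 ∨ (1 ≤ i ∧ i < n - 1) := by omega
      · simp [h0]
      · rw [List.getElem_append_right (by simp; omega)]
        simp [h1]
      · rw [List.getElem_append_left (by simp; omega),
          List.getElem_append_right (by simp; omega)]
        simp only [List.getElem_take, List.getElem_drop, List.length_singleton]
        congr 1; omega

theorem exists_eq_cons_cons_append_iff {α : Type*} {a : α} {W : List α} {n : ℕ}
    (hW : W.length = n) (hn : 5 ≤ n) (h0 : W.getD 0 a = a) (h1 : W.getD (n - 1) a = a) :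
    (∃ A, A ≠ [] ∧ W = [a] ++ [a] ++ A ++ [a] ++ [a]) ↔
      W.getD 1 a = a ∧ W.getD (n - 2) a = a := by
  constructor
  · rintro ⟨A, -, rfl⟩
    simp at hW
    subst hW
    simp
  · rintro ⟨h2, h3⟩
    rw [List.getD_eq_getElem _ _ (by omega)] at h0 h1 h2 h3
    refine ⟨(W.take (n - 2)).drop 2, ?_, ?_⟩
    · apply List.ne_nil_of_length_pos; simp; omega
    · rw [List.append_assoc _ [a] [a]]
      refine List.ext_getElem (by simp; omega) fun i hi hi' => ?_
      obtain rfl | rfl | rfl | rfl | h :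
        i = 0 ∨ i = 1 ∨ i = n - 1 ∨ i = n - 2 ∨ (2 ≤ i ∧ i < n - 2) := by omega
      · simp [h0]
      · simp [h2]
      · rw [List.getElem_append_right (by simp; omega)]
        simp only [List.cons_append, List.nil_append, h1]
        grind
      · rw [List.getElem_append_right (by simp; omega)]
        simp only [List.cons_append, List.nil_append, h3]
        grind
      · rw [List.getElem_append_left (by simp; omega),
          List.getElem_append_right (by simp; omega)]
        simp only [List.getElem_take, List.getElem_drop, List.length_append, List.length_singleton]
        congr 1; omega

/-- Passing from lists to padded sequences. -/
theorem card_list_eq_ncard_borderless {α : Type*} (a : α) (P : Prop → Prop) {n : ℕ}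
    (hn : 3 ≤ n) (Q : List α → Prop)
    (hQ : ∀ W : List α, W.length = n → W.getD 0 a = a → W.getD (n - 1) a = a →
      Z2BifixFree W → (Q W ↔ P (W.getD 1 a = a ∧ W.getD (n - 2) a = a))) :
    Nat.card {W : List α // W.length = n ∧ (∃ A, A ≠ [] ∧ W = [a] ++ A ++ [a]) ∧
      Q W ∧ Z2BifixFree W} = (borderless a P n (n - 1)).ncard := by
  have key : ∀ W : List α, W.length = n → ((∃ A, A ≠ [] ∧ W = [a] ++ A ++ [a]) ∧
      Q W ∧ Z2BifixFree W ↔ (fun i => W.getD i a) ∈ borderless a P n (n - 1)) := by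
    intro W hW
    rw [exists_eq_cons_append_iff hW hn]
    constructor
    · rintro ⟨⟨h0, h1⟩, h2, h3⟩
      exact ⟨fun i hi => List.getD_eq_default _ _ (by omega), h0, h1, (hQ W hW h0 h1 h3).1 h2,
        (z2BifixFree_iff hW h0 h1).1 h3⟩
    · rintro ⟨-, h0, h1, h2, h3⟩
      have h4 := (z2BifixFree_iff hW h0 h1).2 h3
      exact ⟨⟨h0, h1⟩, (hQ W hW h0 h1 h4).2 h2, h4⟩
  have hof : ∀ w ∈ borderless a P n (n - 1),
      (fun i => (List.ofFn fun j : Fin n => w j).getD i a) = w := by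
    intro w hw
    funext i
    by_cases hi : i < n
    · simp [hi]
    · rw [List.getD_eq_default _ _ (by simp; omega), hw.1 i (by omega)]
  rw [← Nat.card_coe_set_eq]
  refine Nat.card_congr
    { toFun := fun W => ⟨fun i => W.1.getD i a, (key W.1 W.2.1).1 W.2.2⟩
      invFun := fun w => ⟨List.ofFn fun j : Fin n => w.1 j, by simp,
        (key _ (by simp)).2 (by rw [hof w.1 w.2]; exact w.2)⟩
      left_inv := ?_
      right_inv := fun w => Subtype.ext (hof w.1 w.2) }
  rintro ⟨W, rfl, hW⟩
  refine Subtype.ext (List.ext_getElem (by simp) fun i hi hi' => ?_)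
  simp

section counts

variable {q : ℕ} (a : Fin q)

theorem dCount_singleton {n : ℕ} (hn : 5 ≤ n) :
    dCount q [a] n = (borderless a id n (n - 1)).ncard :=
  card_list_eq_ncard_borderless a id (by omega) _ fun _ hW h0 h1 _ =>
    exists_eq_cons_cons_append_iff hW hn h0 h1

theorem dCount_singleton_of_lt {n : ℕ} (hn : n < 5) : dCount q [a] n = 0 := by
  refine Nat.card_eq_zero.2 (Or.inl ⟨?_⟩)
  rintro ⟨W, hW, -, ⟨A, hA, rfl⟩, -⟩
  have := List.length_pos_of_ne_nil hA
  simp at hW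
  omega

theorem cCount_singleton {n : ℕ} (hn : 4 ≤ n) :
    cCount q [a] n = (borderless a Not n (n - 1)).ncard := by
  refine card_list_eq_ncard_borderless a Not (by omega) _ fun W hW h0 h1 hf => ?_
  obtain rfl | hn : n = 4 ∨ 5 ≤ n := by omega
  · refine iff_of_true ?_ ?_
    · rintro ⟨A, hA, rfl⟩
      exact hA (by simpa using hW)
    · rintro ⟨h2, h3⟩
      refine (z2BifixFree_iff hW h0 h1).1 hf 3 le_rfl (by omega) fun i hi => ?_
      obtain rfl | rfl | rfl : i = 0 ∨ i = 1 ∨ i = 2 := by omega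
      all_goals grind
  · rw [exists_eq_cons_cons_append_iff hW hn h0 h1]

theorem cCount_singleton_three : cCount q [a] 3 = q := by
  have : cCount q [a] 3 = (borderless a (fun _ => True) 3 2).ncard := by
    refine card_list_eq_ncard_borderless a (fun _ => True) le_rfl _ fun W hW _ _ _ => ?_
    refine iff_of_true ?_ trivial
    rintro ⟨A, hA, rfl⟩
    simp at hW
  rw [this, borderless_true_three, Nat.card_fin]

theorem cCount_singleton_of_lt {n : ℕ} (hn : n < 3) : cCount q [a] n = 0 := by
  refine Nat.card_eq_zero.2 (Or.inl ⟨?_⟩)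
  rintro ⟨W, hW, ⟨A, hA, rfl⟩, -⟩
  have := List.length_pos_of_ne_nil hA
  simp at hW
  omega

end counts

/-- The recursion for `cCount` and `dCount` when `L` is a single letter (`ℓ = 1`). -/
theorem cd_recursion_one (q : ℕ) (hq : 1 ≤ q) (L : List (Fin q))
    (hlen : L.length = 1) :
    cCount q L 1 = 0 ∧ cCount q L 2 = 0 ∧
    cCount q L 3 = q ∧
    (cCount q L 4 : ℤ) = q * cCount q L 3 - 1 ∧
    (cCount q L 5 : ℤ) = q * cCount q L 4 - (cCount q L 3 - 1) ∧
    (cCount q L 6 : ℤ) = q * (cCount q L 5 + cCount q L 3 - 1) - (cCount q L 3 - 1) ∧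
    (∀ k, 3 < k →
      (cCount q L (2 * k) : ℤ) =
        q * (cCount q L (2 * k - 1) + cCount q L k) - cCount q L k) ∧
    (∀ k, 2 < k →
      (cCount q L (2 * k + 1) : ℤ) = q * cCount q L (2 * k) - cCount q L (k + 1)) ∧
    dCount q L 1 = 0 ∧ dCount q L 2 = 0 ∧ dCount q L 3 = 0 ∧ dCount q L 4 = 0 ∧
    (dCount q L 5 : ℤ) = q - 1 ∧
    (dCount q L 6 : ℤ) = q * (dCount q L 5 + 1) - 1 ∧
    (∀ k, 3 < k →
      (dCount q L (2 * k) : ℤ) =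
        q * (dCount q L (2 * k - 1) + dCount q L k) - (dCount q L k + dCount q L (k + 1))) ∧
    (∀ k, 2 < k →
      (dCount q L (2 * k + 1) : ℤ) =
        q * (dCount q L (2 * k) + dCount q L (k + 1)) - dCount q L (k + 1)) := by
  obtain ⟨a, rfl⟩ := List.length_eq_one_iff.1 hlen
  have t3 := borderless_id_add_not a 3 2
  have t4 := borderless_id_add_not a 4 2
  rw [borderless_id_of_le_four a (by omega) (by omega), borderless_true_three, Nat.card_fin] at t3
  rw [borderless_id_of_le_four a (by omega) (by omega), borderless_true_four, Nat.card_fin] at t4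
  have d3 : (borderless a id 3 2).ncard = 1 := borderless_id_of_le_four a (by omega) (by omega)
  have d4 : (borderless a id 4 3).ncard = 0 := by
    have : (borderless a id 4 2).ncard =
        (borderless a id 4 3).ncard + (borderless a id 3 2).ncard :=
      borderless_id_ncard_even a (k := 2) le_rfl
    rw [borderless_id_of_le_four a (by omega) (by omega), d3] at this
    omega
  have c4 : cCount q [a] 4 = (borderless a Not 4 2).ncard := by
    rw [cCount_singleton a le_rfl]
    exact (borderless_not_ncard_even a (k := 2) le_rfl).symm
  have oddC : ∀ k, 2 ≤ k → cCount q [a] (2 * k + 1) + (borderless a Not (k + 1) k).ncard =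
      q * cCount q [a] (2 * k) := by
    intro k hk
    rw [cCount_singleton a (n := 2 * k + 1) (by omega), cCount_singleton a (n := 2 * k) (by omega),
      Nat.add_sub_cancel, borderless_ncard_odd a Not hk, borderless_not_ncard_even a hk,
      Nat.card_fin]
  have evenC : ∀ k, 3 ≤ k → cCount q [a] (2 * k) + (borderless a Not k (k - 1)).ncard =
      q * (cCount q [a] (2 * k - 1) + (borderless a Not k (k - 1)).ncard) := by
    intro k hk
    rw [cCount_singleton a (n := 2 * k) (by omega),
      cCount_singleton a (n := 2 * k - 1) (by omega),
      ← borderless_not_ncard_even a (by omega), borderless_ncard_middle a Not hk,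
      borderless_ncard_middle_odd a Not hk, Nat.card_fin]
    rfl
  have oddD : ∀ k, 2 ≤ k → dCount q [a] (2 * k + 1) + (borderless a id (k + 1) k).ncard =
      q * ((borderless a id (2 * k) (2 * k - 1)).ncard + (borderless a id (k + 1) k).ncard) := by
    intro k hk
    rw [dCount_singleton a (n := 2 * k + 1) (by omega), Nat.add_sub_cancel,
      borderless_ncard_odd a id hk,
      borderless_id_ncard_even a hk, Nat.card_fin]
  have evenD : ∀ k, 3 ≤ k → dCount q [a] (2 * k) + (borderless a id (k + 1) k).ncard +
      (borderless a id k (k - 1)).ncard =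
      q * (dCount q [a] (2 * k - 1) + (borderless a id k (k - 1)).ncard) := by
    intro k hk
    rw [dCount_singleton a (n := 2 * k) (by omega),
      dCount_singleton a (n := 2 * k - 1) (by omega),
      ← borderless_id_ncard_even a (by omega), borderless_ncard_middle a id hk,
      borderless_ncard_middle_odd a id hk, Nat.card_fin]
    rfl
  refine ⟨cCount_singleton_of_lt a (by omega), cCount_singleton_of_lt a (by omega),
    cCount_singleton_three a, ?_, ?_, ?_, fun k hk => ?_, fun k hk => ?_,
    dCount_singleton_of_lt a (by omega), dCount_singleton_of_lt a (by omega),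
    dCount_singleton_of_lt a (by omega), dCount_singleton_of_lt a (by omega), ?_, ?_,
    fun k hk => ?_, fun k hk => ?_⟩
  · rw [cCount_singleton_three, c4]
    zify at t4
    linarith
  · have := oddC 2 le_rfl
    rw [cCount_singleton_three]
    zify at this t3
    norm_num at this
    linarith
  · have := evenC 3 le_rfl
    rw [cCount_singleton_three]
    zify at this t3
    norm_num at this
    have e : ((borderless a Not 3 2).ncard : ℤ) = q - 1 := by linarith
    rw [e] at this
    linarith
  · have := evenC k (by omega)
    rw [← cCount_singleton a (n := k) (by omega)] at this
    zify at this
    linarith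
  · have := oddC k (by omega)
    have e := cCount_singleton a (n := k + 1) (by omega)
    rw [Nat.add_sub_cancel] at e
    rw [← e] at this
    zify at this
    linarith
  · have := oddD 2 le_rfl
    norm_num [d3, d4] at this
    zify at this
    linarith
  · have := evenD 3 le_rfl
    norm_num [d3, d4] at this
    zify at this
    linarith
  · have := evenD k (by omega)
    have e := dCount_singleton a (n := k + 1) (by omega)
    rw [Nat.add_sub_cancel] at e
    have e' : (borderless a id k (k - 1)).ncard = dCount q [a] k := by
      obtain rfl | h : k = 4 ∨ 5 ≤ k := by omega
      · rw [dCount_singleton_of_lt a (by omega)]; exact d4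
      · exact (dCount_singleton a h).symm
    rw [← e, e'] at this
    zify at this
    linarith
  · have := oddD k (by omega)
    have e' : (borderless a id (k + 1) k).ncard = dCount q [a] (k + 1) := by
      obtain rfl | h : k = 3 ∨ 4 ≤ k := by omega
      · rw [dCount_singleton_of_lt a (by omega)]; exact d4
      · exact (dCount_singleton a (n := k + 1) (by omega)).symm
    rw [← dCount_singleton a (n := 2 * k) (by omega), e'] at this
    zify at this
    linarith
end

section
/- For every integer q ≥ 2, the limit lim_{n→∞} II_n(Z_3, q) exists and equals ∑_L ∑_{m=1}^∞ b_m^L · q^{−2m}, where the outer sum ranges over all nonempty bifix-free words L over [q], and all the series involved converge. -/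
/-- A word is a `Z₃`-instance if it has the form `ABACABA` with `A, B, C` nonempty. -/
def Z3Instance {α : Type*} (W : List α) : Prop :=
  ∃ A B C : List α, A ≠ [] ∧ B ≠ [] ∧ C ≠ [] ∧
    W = A ++ B ++ A ++ C ++ A ++ B ++ A

/-- `instProb3 q n` is the probability that a uniformly random word of length `n`
over a `q`-letter alphabet is a `Z₃`-instance. -/
noncomputable def instProb3 (q n : ℕ) : ℝ :=
  (Nat.card {W : List (Fin q) // W.length = n ∧ Z3Instance W} : ℝ) / (q : ℝ) ^ n

/-- For a fixed word `L`, `bCount q L m` counts the `Z₂`-bifix-free words of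
length `m` over `[q]` of the form `LAL` with `A` nonempty. -/
noncomputable def bCount (q : ℕ) (L : List (Fin q)) (m : ℕ) : ℕ :=
  Nat.card {W : List (Fin q) // W.length = m ∧ (∃ A, A ≠ [] ∧ W = L ++ A ++ L) ∧
    Z2BifixFree W}

/-- `V` satisfies `P`, but none of its bifixes does. -/
def BifixMinimal {α : Type*} (P : List α → Prop) (V : List α) : Prop :=
  P V ∧ ∀ U, ¬ (IsBifix U V ∧ P U)

theorem isBifix_of_prefix_of_suffix {α : Type*} {U V : List α} (hU : U ≠ [])
    (hp : U <+: V) (hs : U <:+ V) (hlt : U.length < V.length) : IsBifix U V := by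
  obtain ⟨A, rfl⟩ := hp
  obtain ⟨B, hB⟩ := hs
  refine ⟨hU, ⟨A, ?_, rfl⟩, ⟨B, ?_, hB.symm⟩⟩
  · rintro rfl
    simp at hlt
  · rintro rfl
    simp [← hB] at hlt

theorem BifixMinimal.length_le {α : Type*} {P : List α → Prop} (hP : ∀ V, P V → V ≠ [])
    {U V W : List α} (hU : BifixMinimal P U) (hV : BifixMinimal P V)
    (hUp : U <+: W) (hUs : U <:+ W) (hVp : V <+: W) (hVs : V <:+ W) :
    V.length ≤ U.length := by
  by_contra! hlt
  exact hV.2 U ⟨isBifix_of_prefix_of_suffix (hP U hU.1)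
    (List.prefix_of_prefix_length_le hUp hVp hlt.le)
    (List.suffix_of_suffix_length_le hUs hVs hlt.le) hlt, hU.1⟩

theorem BifixMinimal.eq_of_append_eq {α : Type*} {P : List α → Prop} (hP : ∀ V, P V → V ≠ [])
    {U V C D : List α} (hU : BifixMinimal P U) (hV : BifixMinimal P V)
    (h : U ++ C ++ U = V ++ D ++ V) : U = V := by
  have hUp : U <+: U ++ C ++ U := ⟨C ++ U, by simp⟩
  have hUs : U <:+ U ++ C ++ U := ⟨U ++ C, rfl⟩
  have hVp : V <+: U ++ C ++ U := ⟨D ++ V, by simp [h]⟩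
  have hVs : V <:+ U ++ C ++ U := ⟨V ++ D, h.symm⟩
  exact (List.prefix_of_prefix_length_le hUp hVp
    (hV.length_le hP hU hVp hVs hUp hUs)).eq_of_length_le
    (hU.length_le hP hV hUp hUs hVp hVs)

theorem exists_bifixMinimal {α : Type*} {P : List α → Prop} (V C : List α)
    (hV : P V) (hC : C ≠ []) :
    ∃ U D, BifixMinimal P U ∧ D ≠ [] ∧ V ++ C ++ V = U ++ D ++ U := by
  induction hn : V.length using Nat.strong_induction_on generalizing V C with
  | _ n ih =>
    by_cases hmin : BifixMinimal P V
    · exact ⟨V, C, hmin, hC, rfl⟩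
    · simp only [BifixMinimal, hV, true_and, not_forall, not_not] at hmin
      obtain ⟨U, ⟨-, ⟨A, hA, hVA⟩, ⟨B, -, hVB⟩⟩, hPU⟩ := hmin
      have hlt : U.length < n := by
        have := List.length_pos_iff.mpr hA
        rw [← hn, hVA, List.length_append]
        omega
      obtain ⟨U', D, hU', hD, h⟩ := ih _ hlt U (A ++ C ++ B) hPU (by simp [hA]) rfl
      refine ⟨U', D, hU', hD, ?_⟩
      rw [← h]
      nth_rewrite 1 [hVA]
      rw [hVB]
      simp

theorem Z2Instance.ne_nil {α : Type*} {V : List α} (hV : Z2Instance V) : V ≠ [] := by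
  obtain ⟨A, B, hA, -, rfl⟩ := hV
  simp [hA]

theorem bifixMinimal_ne_nil_iff {α : Type*} {L : List α} :
    BifixMinimal (· ≠ []) L ↔ L ≠ [] ∧ BifixFree L := by
  refine and_congr_right fun _ => forall_congr' fun U => not_congr ?_
  exact ⟨And.left, fun h => ⟨h, h.1⟩⟩

theorem z3Instance_iff {α : Type*} {W : List α} :
    Z3Instance W ↔ ∃ V C, Z2Instance V ∧ C ≠ [] ∧ W = V ++ C ++ V := by
  constructor
  · rintro ⟨A, B, C, hA, hB, hC, rfl⟩
    exact ⟨A ++ B ++ A, C, ⟨A, B, hA, hB, rfl⟩, hC, by simp⟩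
  · rintro ⟨_, C, ⟨A, B, hA, hB, rfl⟩, hC, rfl⟩
    exact ⟨A, B, C, hA, hB, hC, by simp⟩

instance finite_words_of_length {α : Type*} [Finite α] (m : ℕ) (p : List α → Prop) :
    Finite {V : List α // V.length = m ∧ p V} :=
  ((List.finite_length_eq α m).subset fun _ hV => hV.1).to_subtype

/-- Factoring out the shortest bifix that is a `Z₂`-instance counts the `Z₃`-instances. -/
theorem card_z3Instance (q n : ℕ) :
    Nat.card {W : List (Fin q) // W.length = n ∧ Z3Instance W} =
      ∑ m ∈ Finset.range ((n + 1) / 2),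
        Nat.card {V : List (Fin q) // V.length = m ∧ BifixMinimal Z2Instance V} *
          q ^ (n - 2 * m) := by
  have key : Nat.card ((m : Fin ((n + 1) / 2)) ×
      ({V : List (Fin q) // V.length = m ∧ BifixMinimal Z2Instance V} ×
        List.Vector (Fin q) (n - 2 * m))) =
      Nat.card {W : List (Fin q) // W.length = n ∧ Z3Instance W} := by
    refine Nat.card_eq_of_bijective (fun x => ⟨x.2.1.1 ++ x.2.2.1 ++ x.2.1.1, ?_, ?_⟩) ⟨?_, ?_⟩
    · have h := x.1.2
      simp only [List.length_append, x.2.1.2.1, x.2.2.2]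
      omega
    · refine z3Instance_iff.mpr ⟨_, _, x.2.1.2.2.1, ?_, rfl⟩
      have h := x.1.2
      rw [← List.length_pos_iff, x.2.2.2]
      omega
    · rintro ⟨m, ⟨V, hVm, hV⟩, ⟨C, hC⟩⟩ ⟨m', ⟨V', hVm', hV'⟩, ⟨C', hC'⟩⟩ h
      simp only [Subtype.mk.injEq] at h
      obtain rfl := hV.eq_of_append_eq (fun _ => Z2Instance.ne_nil) hV' h
      obtain rfl : m = m' := Fin.ext (hVm.symm.trans hVm')
      obtain rfl : C = C' := by simpa using h
      rfl
    · rintro ⟨W, hW, hZ⟩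
      obtain ⟨V, C, hV, hC, rfl⟩ := z3Instance_iff.mp hZ
      obtain ⟨U, D, hU, hD, h⟩ := exists_bifixMinimal V C hV hC
      have hlen := congrArg List.length h
      have hpos := List.length_pos_iff.mpr hD
      simp only [List.length_append] at hlen hW
      exact ⟨⟨⟨U.length, by omega⟩, ⟨U, rfl, hU⟩, ⟨D, by simp only; omega⟩⟩,
        Subtype.ext h.symm⟩
  rw [← key, Nat.card_sigma, ← Fin.sum_univ_eq_sum_range (fun m =>
    Nat.card {V : List (Fin q) // V.length = m ∧ BifixMinimal Z2Instance V} * q ^ (n - 2 * m))]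
  refine Finset.sum_congr rfl fun m _ => ?_
  rw [Nat.card_prod, Nat.card_eq_fintype_card (α := List.Vector _ _), card_vector,
    Fintype.card_fin]

theorem summable_inv_sq_pow_length {q : ℕ} (hq : 2 ≤ q) :
    Summable fun V : List (Fin q) => (((q : ℝ) ^ 2)⁻¹) ^ V.length := by
  rw [← (Equiv.sigmaFiberEquiv (List.length (α := Fin q))).summable_iff,
    summable_sigma_of_nonneg fun _ => by simp only [Function.comp_apply]; positivity]
  have hfin (m : ℕ) : Fintype {V : List (Fin q) // V.length = m} :=
    inferInstanceAs (Fintype (List.Vector (Fin q) m))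
  have hcard (m : ℕ) : Nat.card {V : List (Fin q) // V.length = m} = q ^ m := by
    change Nat.card (List.Vector (Fin q) m) = _
    rw [Nat.card_eq_fintype_card, card_vector, Fintype.card_fin]
  have hq0 : (q : ℝ) ≠ 0 := by positivity
  refine ⟨fun m => (hasSum_fintype _).summable, ?_⟩
  have hgeom : Summable fun m : ℕ => ((q : ℝ)⁻¹) ^ m :=
    summable_geometric_of_lt_one (by positivity)
      (inv_lt_one_of_one_lt₀ (by exact_mod_cast hq))
  refine hgeom.congr fun m => ?_
  have hconst : ∀ V : {V : List (Fin q) // V.length = m},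
      (((q : ℝ) ^ 2)⁻¹) ^ V.1.length = (((q : ℝ) ^ 2)⁻¹) ^ m := fun V => by rw [V.2]
  simp only [Function.comp_apply, Equiv.sigmaFiberEquiv, Equiv.coe_fn_mk, hconst, tsum_const,
    hcard, nsmul_eq_mul, Nat.cast_pow]
  rw [← mul_pow]
  congr 1
  field_simp

theorem hasSum_card_mul_inv_sq_pow {q : ℕ} (hq : 2 ≤ q) (p : List (Fin q) → Prop) :
    HasSum (fun m : ℕ => (Nat.card {V : List (Fin q) // V.length = m ∧ p V} : ℝ) *
      (((q : ℝ) ^ 2)⁻¹) ^ m) (∑' V : {V // p V}, (((q : ℝ) ^ 2)⁻¹) ^ V.1.length) := by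
  have hs : Summable fun V : {V // p V} => (((q : ℝ) ^ 2)⁻¹) ^ V.1.length :=
    (summable_inv_sq_pow_length hq).subtype {V | p V}
  have h := hs.hasSum
  rw [← (Equiv.sigmaFiberEquiv fun V : {V // p V} => V.1.length).hasSum_iff] at h
  refine h.sigma fun m => ?_
  let e : {V : {V // p V} // V.1.length = m} ≃ {V : List (Fin q) // V.length = m ∧ p V} :=
    (Equiv.subtypeSubtypeEquivSubtypeInter p fun V => V.length = m).trans
      (Equiv.subtypeEquivRight fun _ => and_comm)
  have : Finite {V : {V // p V} // V.1.length = m} := Finite.of_equiv _ e.symm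
  have := Fintype.ofFinite {V : {V // p V} // V.1.length = m}
  have hconst : ∀ V : {V : {V // p V} // V.1.length = m},
      (((q : ℝ) ^ 2)⁻¹) ^ V.1.1.length = (((q : ℝ) ^ 2)⁻¹) ^ m := fun V => by rw [V.2]
  have hc := hasSum_fintype fun _ : {V : {V // p V} // V.1.length = m} => (((q : ℝ) ^ 2)⁻¹) ^ m
  rw [Finset.sum_const, Finset.card_univ, nsmul_eq_mul, ← Nat.card_eq_fintype_card,
    Nat.card_congr e] at hc
  convert hc using 1
  exact funext hconst

theorem bCount_zero {q : ℕ} {L : List (Fin q)} (hL : L ≠ []) : bCount q L 0 = 0 := by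
  have : IsEmpty {W : List (Fin q) // W.length = 0 ∧ (∃ A, A ≠ [] ∧ W = L ++ A ++ L) ∧
      Z2BifixFree W} := by
    refine ⟨?_⟩
    rintro ⟨W, hW, ⟨A, -, rfl⟩, -⟩
    simp [hL] at hW
  exact Nat.card_of_isEmpty

theorem hasSum_bCount {q : ℕ} (hq : 2 ≤ q) {L : List (Fin q)} (hL : L ≠ []) :
    HasSum (fun m : ℕ => (bCount q L (m + 1) : ℝ) * (q : ℝ) ^ (-(2 : ℤ) * (m + 1)))
      (∑' V : {V // (∃ A, A ≠ [] ∧ V = L ++ A ++ L) ∧ Z2BifixFree V},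
        (((q : ℝ) ^ 2)⁻¹) ^ V.1.length) := by
  have h : HasSum (fun m : ℕ => (bCount q L m : ℝ) * (((q : ℝ) ^ 2)⁻¹) ^ m) _ :=
    hasSum_card_mul_inv_sq_pow hq fun V => (∃ A, A ≠ [] ∧ V = L ++ A ++ L) ∧ Z2BifixFree V
  rw [← hasSum_nat_add_iff' 1, Finset.sum_range_one, bCount_zero hL, Nat.cast_zero, zero_mul,
    sub_zero] at h
  have hpow (m : ℕ) : (q : ℝ) ^ (-(2 : ℤ) * (m + 1)) = (((q : ℝ) ^ 2)⁻¹) ^ (m + 1) := by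
    rw [zpow_mul, zpow_neg]
    exact_mod_cast rfl
  simp only [hpow]
  exact h

/-- Factoring out the shortest bifix partitions the `Z₂`-instances. -/
noncomputable def sigmaEquivBifixMinimal (α : Type*) :
    ((L : {L : List α // L ≠ [] ∧ BifixFree L}) ×
      {V : List α // (∃ A, A ≠ [] ∧ V = L.1 ++ A ++ L.1) ∧ Z2BifixFree V}) ≃
    {V : List α // BifixMinimal Z2Instance V} :=
  Equiv.ofBijective
    (fun x => ⟨x.2.1, by
      obtain ⟨A, hA, h⟩ := x.2.2.1
      exact ⟨x.1.1, A, x.1.2.1, hA, h⟩, x.2.2.2⟩) <| by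
    constructor
    · rintro ⟨⟨L, hL⟩, ⟨V, ⟨A, hA, hV⟩, hV2⟩⟩ ⟨⟨L', hL'⟩, ⟨V', ⟨A', hA', hV'⟩, hV2'⟩⟩ h
      obtain rfl : V = V' := congrArg Subtype.val h
      obtain rfl := (bifixMinimal_ne_nil_iff.mpr hL).eq_of_append_eq (fun _ => id)
        (bifixMinimal_ne_nil_iff.mpr hL') (hV.symm.trans hV')
      rfl
    · rintro ⟨V, ⟨A, B, hA, hB, rfl⟩, hV2⟩
      obtain ⟨L, C, hL, hC, h⟩ := exists_bifixMinimal (P := (· ≠ [])) A B hA hB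
      exact ⟨⟨⟨L, bifixMinimal_ne_nil_iff.mp hL⟩, ⟨_, ⟨C, hC, h⟩, hV2⟩⟩, rfl⟩

theorem instProb3_eq_sum {q : ℕ} (hq : 2 ≤ q) (n : ℕ) :
    instProb3 q n = ∑ m ∈ Finset.range ((n + 1) / 2),
      (Nat.card {V : List (Fin q) // V.length = m ∧ BifixMinimal Z2Instance V} : ℝ) *
        (((q : ℝ) ^ 2)⁻¹) ^ m := by
  have hq0 : (q : ℝ) ≠ 0 := by positivity
  rw [instProb3, card_z3Instance, Nat.cast_sum, Finset.sum_div]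
  refine Finset.sum_congr rfl fun m hm => ?_
  have hmn : 2 * m ≤ n := by
    have := Finset.mem_range.mp hm
    omega
  rw [Nat.cast_mul, Nat.cast_pow, mul_div_assoc, pow_sub₀ _ hq0 hmn, inv_pow, ← pow_mul]
  congr 1
  field_simp

/-- For `q ≥ 2`, the asymptotic probability of being a `Z₃`-instance exists and
equals `∑_L ∑_{m≥1} b_m^L q^{−2m}`, the outer sum ranging over all nonempty
bifix-free words `L` over `[q]`; all the series involved converge. -/
theorem instProb3_tendsto_bSum (q : ℕ) (hq : 2 ≤ q) :
    (∀ L : List (Fin q), L ≠ [] → BifixFree L →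
      Summable (fun m : ℕ =>
        (bCount q L (m + 1) : ℝ) * (q : ℝ) ^ (-(2 : ℤ) * (m + 1)))) ∧
    Summable (fun L : {L : List (Fin q) // L ≠ [] ∧ BifixFree L} =>
      ∑' m : ℕ, (bCount q L.1 (m + 1) : ℝ) * (q : ℝ) ^ (-(2 : ℤ) * (m + 1))) ∧
    Filter.Tendsto (fun n => instProb3 q n) Filter.atTop
      (nhds (∑' L : {L : List (Fin q) // L ≠ [] ∧ BifixFree L},
        ∑' m : ℕ, (bCount q L.1 (m + 1) : ℝ) * (q : ℝ) ^ (-(2 : ℤ) * (m + 1)))) := by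
  have hsum : Summable fun x : ((L : {L : List (Fin q) // L ≠ [] ∧ BifixFree L}) ×
      {V : List (Fin q) // (∃ A, A ≠ [] ∧ V = L.1 ++ A ++ L.1) ∧ Z2BifixFree V}) =>
      (((q : ℝ) ^ 2)⁻¹) ^ x.2.1.length :=
    (sigmaEquivBifixMinimal (Fin q)).summable_iff.mpr
      ((summable_inv_sq_pow_length hq).subtype {V | BifixMinimal Z2Instance V})
  have hinner (L : {L : List (Fin q) // L ≠ [] ∧ BifixFree L}) := (hasSum_bCount hq L.2.1).tsum_eq
  refine ⟨fun L hL _ => (hasSum_bCount hq hL).summable, ?_, ?_⟩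
  · simp only [hinner]
    exact hsum.sigma
  · simp only [hinner]
    have htotal := (sigmaEquivBifixMinimal (Fin q)).tsum_eq
      fun V : {V // BifixMinimal Z2Instance V} => (((q : ℝ) ^ 2)⁻¹) ^ V.1.length
    rw [← hsum.tsum_sigma]
    refine htotal ▸ ?_
    simp only [instProb3_eq_sum hq]
    refine (hasSum_card_mul_inv_sq_pow hq (BifixMinimal Z2Instance)).tendsto_sum_nat.comp
      (Filter.tendsto_atTop_mono (f := fun n => n / 2) (fun n => by omega) ?_)
    exact Nat.tendsto_div_const_atTop two_ne_zero
end

section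
/- For all integers n ≥ 1 and q ≥ 1, liminf_{m→∞} II_m(Z_n, q) ≥ q^{n+1−2^n}. -/
/-- `ZnInstance n W` says `W` is an instance of the `n`-th Zimin word: there are
nonempty words `A₁, …, Aₙ` with `W = Wₙ`, where `W₁ = A₁` and
`W_{k+1} = W_k A_{k+1} W_k`.  (The fold starting at `ε` realizes exactly this.) -/
def ZnInstance {α : Type*} (n : ℕ) (W : List α) : Prop :=
  ∃ As : List (List α), As.length = n ∧ (∀ A ∈ As, A ≠ []) ∧
    W = As.foldl (fun X A => X ++ A ++ X) []

/-- `instProbZ n q m` is the probability that a uniformly random word of length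
`m` over a `q`-letter alphabet is a `Zₙ`-instance. -/
noncomputable def instProbZ (n q m : ℕ) : ℝ :=
  (Nat.card {W : List (Fin q) // W.length = m ∧ ZnInstance n W} : ℝ) / (q : ℝ) ^ m

theorem foldl_zimin_length {α : Type*} (as : List α) (X : List α) :
    ((as.map fun a => [a]).foldl (fun X A => X ++ A ++ X) X).length + 1 =
      2 ^ as.length * (X.length + 1) := by
  induction as generalizing X with
  | nil => simp
  | cons a as ih =>
    simp only [List.map_cons, List.foldl_cons, ih, List.length_cons, List.length_append,
      List.length_nil]
    ring

theorem foldl_zimin_inj {α : Type*} {as bs X Y : List α} (hl : as.length = bs.length)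
    (hXY : X.length = Y.length)
    (h : (as.map fun a => [a]).foldl (fun X A => X ++ A ++ X) X =
      (bs.map fun a => [a]).foldl (fun X A => X ++ A ++ X) Y) : as = bs ∧ X = Y := by
  induction as generalizing X Y bs with
  | nil =>
    obtain rfl := List.length_eq_zero_iff.mp hl.symm
    simpa using h
  | cons a as ih =>
    cases bs with
    | nil => simp at hl
    | cons b bs =>
      obtain ⟨h₁, h₂⟩ := ih (X := X ++ [a] ++ X) (Y := Y ++ [b] ++ Y)
        (by simpa using hl) (by simp [hXY]) h
      obtain ⟨h₃, -⟩ := List.append_inj h₂ (by simp [hXY])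
      obtain ⟨h₄, h₅⟩ := List.append_inj h₃ hXY
      simp_all

/-- Forget that a word of length `m` is a `Zₙ`-instance. -/
def znInstanceToVector (n q m : ℕ)
    (W : {W : List (Fin q) // W.length = m ∧ ZnInstance n W}) : List.Vector (Fin q) m :=
  ⟨W.1, W.2.1⟩

theorem znInstanceToVector_injective (n q m : ℕ) :
    Function.Injective (znInstanceToVector n q m) := by
  intro W V h
  apply Subtype.ext
  exact congrArg (fun v : List.Vector (Fin q) m => v.1) h

instance finite_znInstance (n q m : ℕ) :
    Finite {W : List (Fin q) // W.length = m ∧ ZnInstance n W} :=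
  Finite.of_injective _ (znInstanceToVector_injective n q m)

theorem card_znInstance_le (n q m : ℕ) :
    Nat.card {W : List (Fin q) // W.length = m ∧ ZnInstance n W} ≤ q ^ m := by
  have h := Nat.card_le_card_of_injective _ (znInstanceToVector_injective n q m)
  rwa [Nat.card_eq_fintype_card (α := List.Vector (Fin q) m), card_vector,
    Fintype.card_fin] at h

theorem le_card_znInstance (N q k : ℕ) (hk : 1 ≤ k) :
    q ^ (N + k) ≤ Nat.card {W : List (Fin q) //
      W.length = 2 * (2 ^ N - 1) + k ∧ ZnInstance (N + 1) W} := by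
  let Z : List (Fin q) → List (Fin q) := fun as =>
    (as.map fun a => [a]).foldl (fun X A => X ++ A ++ X) []
  have hZ (v : List.Vector (Fin q) N) : (Z v.1).length = 2 ^ N - 1 := by
    have := foldl_zimin_length v.1 []
    rw [v.2] at this
    simp only [List.length_nil, zero_add, mul_one] at this
    exact Nat.eq_sub_of_add_eq this
  let f : List.Vector (Fin q) N × List.Vector (Fin q) k → {W : List (Fin q) //
      W.length = 2 * (2 ^ N - 1) + k ∧ ZnInstance (N + 1) W} := fun p =>
    ⟨Z p.1.1 ++ p.2.1 ++ Z p.1.1, by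
      have := p.2.2
      simp only [List.length_append, hZ]
      omega, (p.1.1.map fun a => [a]) ++ [p.2.1], by simp [p.1.2], by
      intro A hA
      simp only [List.mem_append, List.mem_map, List.mem_singleton] at hA
      rcases hA with ⟨a, -, rfl⟩ | rfl
      · simp
      · exact List.ne_nil_of_length_pos (by have := p.2.2; omega), by
      simp [Z, List.foldl_append]⟩
  have hf : Function.Injective f := by
    rintro ⟨v, w⟩ ⟨v', w'⟩ h
    obtain ⟨h₁, -⟩ := List.append_inj (congrArg Subtype.val h)
      (by simp only [List.length_append, hZ, w.2, w'.2])
    obtain ⟨h₂, h₃⟩ := List.append_inj h₁ (by simp only [hZ])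
    exact Prod.ext (Subtype.ext (foldl_zimin_inj (v.2.trans v'.2.symm) rfl h₂).1)
      (Subtype.ext h₃)
  have h := Nat.card_le_card_of_injective f hf
  simpa [Nat.card_eq_fintype_card, card_vector, pow_add] using h

/-- For `n ≥ 1`, `q ≥ 1`: `liminf_m II_m(Zₙ, q) ≥ q^{n+1−2^n}`. -/
theorem liminf_instProbZ_ge (n q : ℕ) (hn : 1 ≤ n) (hq : 1 ≤ q) :
    (q : ℝ) ^ ((n : ℤ) + 1 - 2 ^ n) ≤
      Filter.liminf (fun m => instProbZ n q m) Filter.atTop := by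
  have hq₀ : (0 : ℝ) < q := by exact_mod_cast hq
  have hle (m : ℕ) : instProbZ n q m ≤ 1 :=
    div_le_one_of_le₀ (by exact_mod_cast card_znInstance_le n q m) (by positivity)
  refine Filter.le_liminf_of_le
    (Filter.isBoundedUnder_of ⟨1, hle⟩).isCoboundedUnder_ge ?_
  filter_upwards [Filter.eventually_ge_atTop (2 ^ n)] with m hm
  obtain ⟨N, rfl⟩ := Nat.exists_eq_add_of_le' hn
  have hN : 1 ≤ 2 ^ N := Nat.one_le_two_pow
  obtain ⟨k, hk, rfl⟩ : ∃ k, 1 ≤ k ∧ m = 2 * (2 ^ N - 1) + k :=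
    ⟨m - 2 * (2 ^ N - 1), by rw [pow_succ] at hm; omega, by rw [pow_succ] at hm; omega⟩
  rw [instProbZ, le_div_iff₀ (by positivity), ← zpow_natCast, ← zpow_add₀ hq₀.ne']
  have hexp : ((N + 1 : ℕ) : ℤ) + 1 - 2 ^ (N + 1) + ((2 * (2 ^ N - 1) + k : ℕ) : ℤ) =
      ((N + k : ℕ) : ℤ) := by
    push_cast [Nat.cast_sub hN]
    ring
  rw [hexp, zpow_natCast]
  exact_mod_cast le_card_znInstance N q k hk
end

section
/- For all integers n ≥ 1 and q ≥ 2, limsup_{m→∞} II_m(Z_n, q) ≤ ∏_{j=1}^{n−1} 1/(q^{2^j−1} − 1), where the empty product (case n = 1) equals 1. -/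
open scoped ENNReal Classical in
/-- The sum of `f` over all instances of the `n`-th Zimin word. -/
noncomputable def znSum {α : Type*} (n : ℕ) (f : List α → ℝ≥0∞) : ℝ≥0∞ :=
  ∑' W, if ZnInstance n W then f W else 0

open scoped ENNReal

theorem znInstance_zero {α : Type*} {W : List α} : ZnInstance 0 W ↔ W = [] := by
  simp [ZnInstance]

theorem ZnInstance.exists_of_succ {α : Type*} {n : ℕ} {W : List α} (h : ZnInstance (n + 1) W) :
    ∃ V A : List α, ZnInstance n V ∧ A ≠ [] ∧ V ++ A ++ V = W := by
  obtain ⟨As, hl, hne, rfl⟩ := h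
  have h0 : As ≠ [] := by rintro rfl; simp at hl
  obtain ⟨Bs, A, rfl⟩ := As.eq_nil_or_concat.resolve_left h0
  refine ⟨Bs.foldl (fun X A => X ++ A ++ X) [], A, ⟨Bs, by simpa using hl, ?_, rfl⟩, ?_, ?_⟩
  · exact fun B hB => hne B (by simp [hB])
  · exact hne A (by simp)
  · simp

theorem znSum_zero {α : Type*} (f : List α → ℝ≥0∞) : znSum 0 f = f [] := by
  classical
  simp only [znSum, znInstance_zero]
  rw [tsum_eq_single []]
  · simp
  · intro W hW
    simp [hW]

open scoped Classical in
theorem znSum_mono {α : Type*} (n : ℕ) {f g : List α → ℝ≥0∞} (h : ∀ W, f W ≤ g W) :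
    znSum n f ≤ znSum n g := by
  refine ENNReal.tsum_le_tsum fun W => ?_
  split_ifs
  exacts [h W, le_rfl]

open scoped Classical in
theorem znSum_mul_right {α : Type*} (n : ℕ) (f : List α → ℝ≥0∞) (c : ℝ≥0∞) :
    znSum n (fun W => f W * c) = znSum n f * c := by
  rw [znSum, znSum, ← ENNReal.tsum_mul_right]
  refine tsum_congr fun W => ?_
  split_ifs <;> simp

open scoped Classical in
theorem znSum_succ_le {α : Type*} (n : ℕ) (f : List α → ℝ≥0∞) :
    znSum (n + 1) f ≤
      znSum n (fun V => ∑' A : List α, if A ≠ [] then f (V ++ A ++ V) else 0) := by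
  calc znSum (n + 1) f
      ≤ ∑' W, ∑' V, ∑' A, if W = V ++ A ++ V then
          (if ZnInstance n V then if A ≠ [] then f (V ++ A ++ V) else 0 else 0) else 0 := by
        refine ENNReal.tsum_le_tsum fun W => ?_
        split_ifs with h
        · obtain ⟨V, A, hV, hA, rfl⟩ := h.exists_of_succ
          refine le_trans ?_ (ENNReal.le_tsum V)
          refine le_trans ?_ (ENNReal.le_tsum A)
          simp [hV, hA]
        · exact zero_le
    _ = ∑' V, ∑' A, ∑' W, if W = V ++ A ++ V then
          (if ZnInstance n V then if A ≠ [] then f (V ++ A ++ V) else 0 else 0) else 0 := by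
        rw [ENNReal.tsum_comm]
        exact tsum_congr fun V => ENNReal.tsum_comm
    _ = _ := by
        refine tsum_congr fun V => ?_
        simp only [tsum_ite_eq]
        split_ifs <;> simp

theorem tsum_list_length (q : ℕ) (h : ℕ → ℝ≥0∞) :
    ∑' A : List (Fin q), h A.length = ∑' a : ℕ, (q : ℝ≥0∞) ^ a * h a := by
  rw [← List.equivSigmaTuple.symm.tsum_eq, ENNReal.tsum_sigma']
  refine tsum_congr fun a => ?_
  simp [List.equivSigmaTuple, tsum_fintype]

open scoped Classical in
theorem tsum_list_length_ne_nil (q : ℕ) (h : ℕ → ℝ≥0∞) :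
    (∑' A : List (Fin q), if A ≠ [] then h A.length else 0) =
      ∑' a : ℕ, (q : ℝ≥0∞) ^ (a + 1) * h (a + 1) := by
  have := tsum_list_length q (fun a => if a ≠ 0 then h a else 0)
  simp only [ne_eq, List.length_eq_zero_iff] at this
  simp only [ne_eq]
  rw [this, tsum_eq_zero_add' ENNReal.summable]
  simp

theorem tsum_geometric_inv_pow {q : ℕ} (hq : 2 ≤ q) {k : ℕ} (hk : 2 ≤ k) :
    ∑' a : ℕ, (q : ℝ≥0∞) ^ (a + 1) * ((q : ℝ≥0∞)⁻¹ ^ k) ^ (a + 1) =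
      ENNReal.ofReal (1 / ((q : ℝ) ^ (k - 1) - 1)) := by
  have hq1 : (1 : ℝ) < q := by exact_mod_cast hq
  have hpow : (1 : ℝ) < (q : ℝ) ^ (k - 1) := one_lt_pow₀ hq1 (by omega)
  set r : ℝ := ((q : ℝ) ^ (k - 1))⁻¹ with hr
  have hr0 : 0 ≤ r := by positivity
  have hr1 : r < 1 := inv_lt_one_of_one_lt₀ hpow
  have hbase : (q : ℝ≥0∞) * (q : ℝ≥0∞)⁻¹ ^ k = ENNReal.ofReal r := by
    obtain ⟨j, rfl⟩ : ∃ j, k = j + 1 := ⟨k - 1, by omega⟩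
    rw [pow_succ', ← mul_assoc, ENNReal.mul_inv_cancel (by simp; omega) (by simp), one_mul, hr,
      Nat.add_sub_cancel, ENNReal.ofReal_inv_of_pos (by positivity),
      ENNReal.ofReal_pow (by positivity), ENNReal.ofReal_natCast, ENNReal.inv_pow]
  simp_rw [← mul_pow, hbase, ← ENNReal.ofReal_pow hr0]
  rw [← ENNReal.ofReal_tsum_of_nonneg (fun a => by positivity)
    ((summable_nat_add_iff 1).2 (summable_geometric_of_lt_one hr0 hr1))]
  simp_rw [pow_succ]
  rw [tsum_mul_right, tsum_geometric_of_lt_one hr0 hr1, hr]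
  congr 1
  have h1 : (q : ℝ) ^ (k - 1) - 1 ≠ 0 := by linarith
  have h2 : (q : ℝ) ^ (k - 1) ≠ 0 := by positivity
  field_simp

theorem znSum_inv_pow_le {q : ℕ} (hq : 2 ≤ q) (n : ℕ) {i : ℕ} (hi : 1 ≤ i) :
    znSum n (fun W : List (Fin q) => ((q : ℝ≥0∞)⁻¹ ^ 2 ^ i) ^ W.length) ≤
      ∏ j ∈ Finset.Ico i (i + n), ENNReal.ofReal (1 / ((q : ℝ) ^ (2 ^ j - 1) - 1)) := by
  classical
  induction n generalizing i with
  | zero => simp [znSum_zero]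
  | succ n ih =>
    have hk : 2 ≤ 2 ^ i := by simpa using Nat.pow_le_pow_right (n := 2) (by norm_num) hi
    refine (znSum_succ_le n _).trans ?_
    have hinner : ∀ V : List (Fin q), (∑' A : List (Fin q), if A ≠ [] then
        ((q : ℝ≥0∞)⁻¹ ^ 2 ^ i) ^ (V ++ A ++ V).length else 0) =
        ((q : ℝ≥0∞)⁻¹ ^ 2 ^ (i + 1)) ^ V.length *
          ENNReal.ofReal (1 / ((q : ℝ) ^ (2 ^ i - 1) - 1)) := by
      intro V
      rw [← tsum_geometric_inv_pow hq hk,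
        ← tsum_list_length_ne_nil q (fun a => ((q : ℝ≥0∞)⁻¹ ^ 2 ^ i) ^ a), ← ENNReal.tsum_mul_left]
      refine tsum_congr fun A => ?_
      split_ifs
      · simp only [List.length_append, ← pow_mul, ← pow_add]
        congr 1
        ring
      · simp
    simp_rw [hinner]
    rw [znSum_mul_right, Finset.prod_eq_prod_Ico_succ_bot (by omega), mul_comm]
    gcongr
    have := ih (i := i + 1) (by omega)
    rwa [show i + 1 + n = i + (n + 1) by ring] at this

theorem ofReal_instProbZ {q : ℕ} (hq : 2 ≤ q) (n m : ℕ) :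
    ENNReal.ofReal (instProbZ n q m) =
      znSum n (fun W : List (Fin q) => if W.length = m then (q : ℝ≥0∞)⁻¹ ^ m else 0) := by
  classical
  have hfin : {W : List (Fin q) | W.length = m ∧ ZnInstance n W}.Finite :=
    (List.finite_length_eq (Fin q) m).subset fun W hW => hW.1
  have : Finite {W : List (Fin q) | W.length = m ∧ ZnInstance n W} := hfin
  have hq0 : (0 : ℝ) < (q : ℝ) ^ m := by positivity
  have hsub : znSum n (fun W : List (Fin q) => if W.length = m then (q : ℝ≥0∞)⁻¹ ^ m else 0) =
      ∑' _ : {W : List (Fin q) | W.length = m ∧ ZnInstance n W}, (q : ℝ≥0∞)⁻¹ ^ m := by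
    rw [tsum_subtype {W : List (Fin q) | W.length = m ∧ ZnInstance n W}
      (fun _ => (q : ℝ≥0∞)⁻¹ ^ m), znSum]
    refine tsum_congr fun W => ?_
    by_cases h1 : W.length = m <;> by_cases h2 : ZnInstance n W <;> simp [h1, h2]
  rw [hsub, ENNReal.tsum_const, instProbZ, ENNReal.ofReal_div_of_pos hq0,
    ENNReal.ofReal_natCast, ENNReal.ofReal_pow (by positivity), ENNReal.ofReal_natCast,
    div_eq_mul_inv, ENNReal.inv_pow, ENat.card_eq_coe_natCard]
  rfl

/-- The bound on the limit superior already holds at every length. -/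
theorem instProbZ_succ_le {q : ℕ} (hq : 2 ≤ q) (n m : ℕ) :
    instProbZ (n + 1) q m ≤ ∏ j ∈ Finset.Icc 1 n, 1 / ((q : ℝ) ^ (2 ^ j - 1) - 1) := by
  classical
  have hq1 : (1 : ℝ) ≤ q := by exact_mod_cast (by omega : 1 ≤ q)
  have hpos : ∀ j ∈ Finset.Icc 1 n, 0 ≤ 1 / ((q : ℝ) ^ (2 ^ j - 1) - 1) := fun j _ =>
    one_div_nonneg.2 (sub_nonneg.2 (one_le_pow₀ hq1))
  rw [← ENNReal.ofReal_le_ofReal_iff (Finset.prod_nonneg hpos), ENNReal.ofReal_prod_of_nonneg hpos,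
    ofReal_instProbZ hq]
  have hIco : Finset.Icc 1 n = Finset.Ico 1 (1 + n) := by ext; simp; omega
  rw [hIco]
  refine (znSum_succ_le n _).trans (le_trans (znSum_mono n fun V => ?_)
    (znSum_inv_pow_le hq n le_rfl))
  have hq0 : (q : ℝ≥0∞) ≠ 0 := by simp; omega
  calc (∑' A : List (Fin q), if A ≠ [] then
          (if (V ++ A ++ V).length = m then (q : ℝ≥0∞)⁻¹ ^ m else 0) else 0)
      ≤ ∑' A : List (Fin q), if V.length + A.length + V.length = m then (q : ℝ≥0∞)⁻¹ ^ m else 0 :=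
        ENNReal.tsum_le_tsum fun A => by
          split_ifs <;> simp_all [add_assoc]
    _ = ∑' a : ℕ, (q : ℝ≥0∞) ^ a *
          (if V.length + a + V.length = m then (q : ℝ≥0∞)⁻¹ ^ m else 0) :=
        tsum_list_length q fun a =>
          if V.length + a + V.length = m then (q : ℝ≥0∞)⁻¹ ^ m else 0
    _ ≤ ∑' a : ℕ, if a = m - 2 * V.length then ((q : ℝ≥0∞)⁻¹ ^ 2 ^ 1) ^ V.length else 0 := by
        refine ENNReal.tsum_le_tsum fun a => ?_
        by_cases h : V.length + a + V.length = m
        · rw [if_pos h, if_pos (by omega), ← h,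
            show V.length + a + V.length = a + 2 ^ 1 * V.length by ring, pow_add, ← mul_assoc,
            ← mul_pow, ENNReal.mul_inv_cancel hq0 (by simp), one_pow, one_mul, pow_mul]
        · simp [h]
    _ = ((q : ℝ≥0∞)⁻¹ ^ 2 ^ 1) ^ V.length := tsum_ite_eq _ _

/-- For `n ≥ 1`, `q ≥ 2`: `limsup_m II_m(Zₙ, q) ≤ ∏_{j=1}^{n−1} 1/(q^{2^j−1} − 1)`
(the empty product for `n = 1` being `1`). -/
theorem limsup_instProbZ_le (n q : ℕ) (hn : 1 ≤ n) (hq : 2 ≤ q) :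
    Filter.limsup (fun m => instProbZ n q m) Filter.atTop ≤
      ∏ j ∈ Finset.Icc 1 (n - 1), 1 / ((q : ℝ) ^ (2 ^ j - 1) - 1) := by
  obtain ⟨n, rfl⟩ : ∃ k, n = k + 1 := ⟨n - 1, by omega⟩
  rw [Nat.add_sub_cancel]
  refine Filter.limsup_le_of_le ?_ (Filter.Eventually.of_forall fun m => instProbZ_succ_le hq n m)
  exact Filter.isCoboundedUnder_le_of_le (x := 0) Filter.atTop fun m => by
    unfold instProbZ
    positivity
end

section
/- For every integer q ≥ 2, define F(i) = (−1)^i q^{1−2^{i+1}} / ∏_{k=0}^{i} (1 − q^{1−2^{k+1}}) for integers i ≥ 0. Then the sequence of absolute values |F(i)| is strictly decreasing: |F(i)| < |F(i−1)| for every integer i ≥ 1. -/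
/-- Term `i` of the series for the asymptotic `Z₂`-instance probability:
`F(i) = (−1)^i q^{1−2^{i+1}} / ∏_{k=0}^{i} (1 − q^{1−2^{k+1}})`. -/
noncomputable def Fterm (q : ℕ) (i : ℕ) : ℝ :=
  (-1 : ℝ) ^ i * (q : ℝ) ^ ((1 : ℤ) - 2 ^ (i + 1)) /
    ∏ k ∈ Finset.range (i + 1), (1 - (q : ℝ) ^ ((1 : ℤ) - 2 ^ (k + 1)))

theorem zpow_one_sub_two_pow_le_half (q : ℕ) (hq : 2 ≤ q) (n : ℕ) :
    (q : ℝ) ^ ((1 : ℤ) - 2 ^ (n + 1)) ≤ 1 / 2 := by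
  have hq' : (2 : ℝ) ≤ q := by exact_mod_cast hq
  have hexp : (1 : ℤ) - 2 ^ (n + 1) ≤ -1 := by
    have : (1 : ℤ) ≤ 2 ^ n := one_le_pow₀ (by norm_num)
    rw [pow_succ]
    linarith
  calc (q : ℝ) ^ ((1 : ℤ) - 2 ^ (n + 1)) ≤ (q : ℝ) ^ (-1 : ℤ) :=
        zpow_le_zpow_right₀ (by linarith) hexp
    _ = (q : ℝ)⁻¹ := zpow_neg_one _
    _ ≤ 1 / 2 := by
        rw [one_div]
        exact inv_anti₀ (by norm_num) hq'

theorem zpow_one_sub_two_pow_succ (q : ℕ) (hq : 2 ≤ q) (n : ℕ) :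
    (q : ℝ) ^ ((1 : ℤ) - 2 ^ (n + 2)) =
      (q : ℝ) ^ ((1 : ℤ) - 2 ^ (n + 1)) * (q : ℝ) ^ ((1 : ℤ) - 2 ^ (n + 1)) / q := by
  have hq0 : (q : ℝ) ≠ 0 := by
    exact_mod_cast (by omega : q ≠ 0)
  rw [← zpow_add₀ hq0, div_eq_mul_inv, ← zpow_sub_one₀ hq0]
  congr 1
  ring

theorem prod_one_sub_zpow_pos (q : ℕ) (hq : 2 ≤ q) (n : ℕ) :
    0 < ∏ k ∈ Finset.range n, (1 - (q : ℝ) ^ ((1 : ℤ) - 2 ^ (k + 1))) :=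
  Finset.prod_pos fun k _ => by linarith [zpow_one_sub_two_pow_le_half q hq k]

theorem abs_Fterm (q : ℕ) (hq : 2 ≤ q) (n : ℕ) :
    |Fterm q n| = (q : ℝ) ^ ((1 : ℤ) - 2 ^ (n + 1)) /
      ∏ k ∈ Finset.range (n + 1), (1 - (q : ℝ) ^ ((1 : ℤ) - 2 ^ (k + 1))) := by
  rw [Fterm, abs_div, abs_mul, abs_pow, abs_neg, abs_one, one_pow, one_mul,
    abs_of_pos (prod_one_sub_zpow_pos q hq _), abs_of_nonneg (by positivity)]

/-- For `q ≥ 2` the sequence `|F(i)|` is strictly decreasing. -/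
theorem Fterm_abs_strictAnti (q : ℕ) (hq : 2 ≤ q) :
    ∀ i : ℕ, 1 ≤ i → |Fterm q i| < |Fterm q (i - 1)| := by
  intro i hi
  obtain ⟨n, rfl⟩ := Nat.exists_eq_add_of_le' hi
  rw [Nat.add_sub_cancel, abs_Fterm q hq, abs_Fterm q hq, Finset.prod_range_succ _ (n + 1)]
  have hP := prod_one_sub_zpow_pos q hq (n + 1)
  have ha := zpow_one_sub_two_pow_le_half q hq n
  have hb := zpow_one_sub_two_pow_le_half q hq (n + 1)
  have hab := zpow_one_sub_two_pow_succ q hq n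
  have hq' : (2 : ℝ) ≤ q := by exact_mod_cast hq
  have ha0 : 0 < (q : ℝ) ^ ((1 : ℤ) - 2 ^ (n + 1)) := zpow_pos (by linarith) _
  rw [show n + 1 + 1 = n + 2 from rfl] at hb ⊢
  set a := (q : ℝ) ^ ((1 : ℤ) - 2 ^ (n + 1))
  set b := (q : ℝ) ^ ((1 : ℤ) - 2 ^ (n + 2))
  set P := ∏ k ∈ Finset.range (n + 1), (1 - (q : ℝ) ^ ((1 : ℤ) - 2 ^ (k + 1)))
  have hba : b ≤ a / 4 := by
    rw [hab, div_le_iff₀ (by linarith)]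
    nlinarith
  rw [div_lt_div_iff₀ (mul_pos hP (by linarith)) hP]
  have key : b < a * (1 - b) := by nlinarith
  calc b * P < a * (1 - b) * P := mul_lt_mul_of_pos_right key hP
    _ = a * (P * (1 - b)) := by ring
end
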